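/- arXiv:0709.4280 — 7 statements merged into one kernel-verified Lean document; each statement's English description precedes it below -/
import Mathlib

section
/- Let G be a group. Then G is amenable if and only if every finite cellular automaton on G that admits mutually erasable patterns also admits a garden of Eden. -/
/-- A group is amenable if it carries a finitely additive, left-translation-invariant
probability measure defined on all subsets. -/
def IsAmenable (G : Type*) [Group G] : Prop :=
  ∃ μ : Set G → ℝ,
    (∀ A : Set G, 0 ≤ μ A) ∧
    μ Set.univ = 1 ∧
    (∀ A B : Set G, Disjoint A B → μ (A ∪ B) = μ A + μ B) ∧
    (∀ (g : G) (A : Set G), μ ((g * ·) '' A) = μ A)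

variable {G : Type*} [Group G]

/-- The evolution of the cellular automaton `θ : Q^S → Q`. -/
def evolve (S : Finset G) {Q : Type*} (θ : (↥S → Q) → Q) (φ : G → Q) : G → Q :=
  fun x => θ (fun s => φ (x * (s : G)))

/-- The automaton `θ` admits a Garden of Eden: a pattern on a finite subset `Y ⊆ G`
to which no configuration in the image of the evolution restricts. -/
def HasGOE (S : Finset G) {Q : Type*} (θ : (↥S → Q) → Q) : Prop :=
  ∃ (Y : Finset G) (p : ↥Y → Q),
    ∀ φ : G → Q, ∃ y : ↥Y, evolve S θ φ (y : G) ≠ p y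

/-- The automaton `θ` admits mutually erasable patterns: two configurations which agree
outside a nonempty finite set, differ somewhere, and have the same image under the
evolution. -/
def HasMEP (S : Finset G) {Q : Type*} (θ : (↥S → Q) → Q) : Prop :=
  ∃ φ₁ φ₂ : G → Q, φ₁ ≠ φ₂ ∧ {x | φ₁ x ≠ φ₂ x}.Finite ∧
    evolve S θ φ₁ = evolve S θ φ₂

section Helpers

open scoped Pointwise
open Finset Filter Topology

theorem exists_mul_pow_lt_succ_pow (q b : ℕ) : ∃ n : ℕ, q * b ^ n < (b + 1) ^ n := by
  rcases Nat.eq_zero_or_pos b with rfl | hb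
  · exact ⟨1, by simp⟩
  have hb' : (0 : ℝ) < b := by exact_mod_cast hb
  obtain ⟨n, hn⟩ := pow_unbounded_of_one_lt (q : ℝ)
    (show (1 : ℝ) < (b + 1) / b by rw [lt_div_iff₀ hb']; linarith)
  refine ⟨n, ?_⟩
  rw [div_pow, lt_div_iff₀ (by positivity)] at hn
  exact_mod_cast hn

/-! ### Følner sets and expansion -/

/-- If some finite set expands every finite set by a definite factor, then some power of it
at least doubles every finite set. -/
theorem exists_doubling_of_expanding [DecidableEq G] {K : Finset G} {N : ℕ}
    (h : ∀ F : Finset G, (N + 1) * #F ≤ N * #(F * K)) :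
    ∃ L : Finset G, ∀ F : Finset G, 2 * #F ≤ #(F * L) := by
  have key : ∀ (n : ℕ) (F : Finset G), (N + 1) ^ n * #F ≤ N ^ n * #(F * K ^ n) := by
    intro n
    induction n with
    | zero => intro F; simp
    | succ n ih =>
      intro F
      calc (N + 1) ^ (n + 1) * #F = (N + 1) * ((N + 1) ^ n * #F) := by ring
        _ ≤ (N + 1) * (N ^ n * #(F * K ^ n)) := Nat.mul_le_mul_left _ (ih F)
        _ = N ^ n * ((N + 1) * #(F * K ^ n)) := by ring
        _ ≤ N ^ n * (N * #(F * K ^ n * K)) := by gcongr N ^ n * ?_; exact h _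
        _ = N ^ (n + 1) * #(F * K ^ (n + 1)) := by rw [mul_assoc F, ← pow_succ]; ring
  obtain ⟨n, hn⟩ := exists_mul_pow_lt_succ_pow 2 N
  refine ⟨K ^ n, fun F => ?_⟩
  by_contra! hlt
  have h1 := key n F
  have h2 : N ^ n * #(F * K ^ n) ≤ N ^ n * (2 * #F) := by gcongr
  have h3 : (2 * N ^ n) * #F < (N + 1) ^ n * #F := by
    apply Nat.mul_lt_mul_of_pos_right hn
    omega
  nlinarith

theorem exists_folner_of_not_doubling [DecidableEq G]
    (h : ¬ ∃ L : Finset G, ∀ F : Finset G, 2 * #F ≤ #(F * L)) (K : Finset G) (N : ℕ) :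
    ∃ F : Finset G, F.Nonempty ∧ N * #(F * K) < (N + 1) * #F := by
  by_contra! hF
  refine h (exists_doubling_of_expanding (K := K) (N := N) fun F => ?_)
  rcases F.eq_empty_or_nonempty with rfl | hne
  · simp
  · exact hF F hne

/-- Hall's marriage theorem turns a doubling set into an injection `G × Bool → G` of bounded
displacement. -/
theorem exists_injective_of_doubling [DecidableEq G] {K : Finset G}
    (h : ∀ F : Finset G, 2 * #F ≤ #(F * K)) :
    ∃ f : G × Bool → G, Function.Injective f ∧ ∀ p, ∃ s ∈ K, f p = p.1 * s := by
  obtain ⟨f, hf, hfK⟩ := (Finset.all_card_le_biUnion_card_iff_exists_injective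
    (fun p : G × Bool => K.image (p.1 * ·))).1 (by
      intro s
      have h1 : #s ≤ #(s.image Prod.fst ×ˢ (univ : Finset Bool)) :=
        card_le_card fun p hp => by
          simpa using (⟨p.2, hp⟩ : ∃ b, (p.1, b) ∈ s)
      have h2 : s.image Prod.fst * K ⊆ s.biUnion fun p => K.image (p.1 * ·) := by
        intro y hy
        obtain ⟨x, hx, k, hk, rfl⟩ := mem_mul.1 hy
        obtain ⟨p, hp, rfl⟩ := mem_image.1 hx
        exact mem_biUnion.2 ⟨p, hp, mem_image_of_mem _ hk⟩
      have h3 := card_le_card h2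
      have h4 := h (s.image Prod.fst)
      rw [card_product, card_univ, Fintype.card_bool] at h1
      omega)
  refine ⟨f, hf, fun p => ?_⟩
  obtain ⟨s, hs, he⟩ := mem_image.1 (hfK p)
  exact ⟨s, hs, he.symm⟩

/-! ### Amenability and doubling -/

theorem finitelyAdditive_biUnion {X ι : Type*} {μ : Set X → ℝ}
    (hadd : ∀ A B : Set X, Disjoint A B → μ (A ∪ B) = μ A + μ B)
    (K : Finset ι) (B : ι → Set X) (hB : (K : Set ι).PairwiseDisjoint B) :
    μ (⋃ s ∈ K, B s) = ∑ s ∈ K, μ (B s) := by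
  classical
  induction K using Finset.induction_on with
  | empty =>
    have := hadd ∅ ∅ (by simp)
    simp at this ⊢
    exact this
  | insert a K ha ih =>
    rw [Finset.set_biUnion_insert, sum_insert ha, hadd, ih]
    · exact hB.subset (by simp)
    · simp only [Set.disjoint_iUnion_right]
      intro s hs
      refine hB (by simp) (by simp [hs]) ?_
      rintro rfl
      exact ha hs

theorem IsAmenable.not_doubling [DecidableEq G] (hG : IsAmenable G) :
    ¬ ∃ L : Finset G, ∀ F : Finset G, 2 * #F ≤ #(F * L) := by
  rintro ⟨K, hK⟩
  obtain ⟨f, hf, hfK⟩ := exists_injective_of_doubling hK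
  choose d hdK hd using hfK
  obtain ⟨μ, hpos, huniv, hadd, hinv⟩ := hG
  have hrange : ∀ b : Bool, μ (Set.range fun x => (f (x⁻¹, b))⁻¹) = 1 := by
    intro b
    let A : G → Set G := fun s => {x | d (x⁻¹, b) = s}
    have hval : ∀ x, (f (x⁻¹, b))⁻¹ = (d (x⁻¹, b))⁻¹ * x := fun x => by simp [hd]
    have hA : μ (⋃ s ∈ K, A s) = ∑ s ∈ K, μ (A s) :=
      finitelyAdditive_biUnion hadd K A fun s _ t _ hst =>
        Set.disjoint_left.2 fun x hx hx' => hst (hx.symm.trans hx')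
    have hB : μ (⋃ s ∈ K, (s⁻¹ * ·) '' A s) = ∑ s ∈ K, μ ((s⁻¹ * ·) '' A s) := by
      refine finitelyAdditive_biUnion hadd K (fun s => (s⁻¹ * ·) '' A s) ?_
      intro s _ t _ hst
      refine Set.disjoint_left.2 ?_
      rintro _ ⟨x, rfl, rfl⟩ ⟨y, rfl, hxy⟩
      simp only [← hval, inv_inj] at hxy
      have := (Prod.mk.inj (hf hxy)).1
      rw [inv_inj] at this
      exact hst (by rw [this])
    have hAu : ⋃ s ∈ K, A s = Set.univ :=
      Set.eq_univ_of_forall fun x => Set.mem_iUnion₂.2 ⟨_, hdK (x⁻¹, b), rfl⟩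
    have hBr : ⋃ s ∈ K, (s⁻¹ * ·) '' A s = Set.range fun x => (f (x⁻¹, b))⁻¹ := by
      ext y
      simp only [Set.mem_iUnion, Set.mem_image, Set.mem_range]
      constructor
      · rintro ⟨s, -, x, rfl, rfl⟩
        exact ⟨x, hval x⟩
      · rintro ⟨x, rfl⟩
        exact ⟨_, hdK (x⁻¹, b), x, rfl, (hval x).symm⟩
    rw [← hBr, hB, sum_congr rfl fun s _ => hinv s⁻¹ (A s), ← hA, hAu, huniv]
  set R : Bool → Set G := fun b => Set.range fun x => (f (x⁻¹, b))⁻¹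
  have hdisj : Disjoint (R true) (R false) := by
    refine Set.disjoint_left.2 ?_
    rintro _ ⟨x, rfl⟩ ⟨y, hxy⟩
    simp only [inv_inj] at hxy
    exact Bool.false_ne_true (Prod.mk.inj (hf hxy)).2
  have h1 := hadd _ _ hdisj
  have h2 := hadd (R true ∪ R false) (R true ∪ R false)ᶜ disjoint_compl_right
  rw [Set.union_compl_self, huniv, h1, hrange, hrange] at h2
  linarith [hpos (R true ∪ R false)ᶜ]

theorem isAmenable_of_not_doubling [DecidableEq G]
    (h : ¬ ∃ L : Finset G, ∀ F : Finset G, 2 * #F ≤ #(F * L)) : IsAmenable G := by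
  classical
  choose F hFne hF using fun i : Finset G × ℕ =>
    exists_folner_of_not_doubling h (insert 1 i.1) (i.2 + 1)
  have hFpos : ∀ i, (0 : ℝ) < #(F i) := fun i => by exact_mod_cast (hFne i).card_pos
  let m : Finset G × ℕ → Set G → ℝ := fun i A => #{x ∈ F i | x⁻¹ ∈ A} / #(F i)
  have hm : ∀ i A, m i A ∈ Set.Icc (0 : ℝ) 1 := fun i A =>
    ⟨by positivity, by
      rw [div_le_one (hFpos i)]
      exact_mod_cast card_filter_le _ _⟩
  let U : Ultrafilter (Finset G × ℕ) := Ultrafilter.of atTop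
  have hU : (U : Filter (Finset G × ℕ)) ≤ atTop := Ultrafilter.of_le atTop
  have hlim : ∀ A : Set G, ∃ a : ℝ, Tendsto (fun i => m i A) U (𝓝 a) := fun A => by
    obtain ⟨a, -, ha⟩ := (isCompact_Icc (a := (0 : ℝ)) (b := 1)).ultrafilter_le_nhds'
      (U.map fun i => m i A) (Ultrafilter.mem_map.2 (Filter.univ_mem' fun i => hm i A))
    exact ⟨a, ha⟩
  choose μ hμ using hlim
  have hle : ∀ (g : G) (A : Set G), μ ((g * ·) '' A) ≤ μ A := by
    intro g A
    have hz : Tendsto (fun i : Finset G × ℕ => 1 / ((i.2 : ℝ) + 1)) U (𝓝 0) :=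
      (tendsto_one_div_add_atTop_nhds_zero_nat.comp
        (tendsto_snd.mono_left (by rw [← prod_atTop_atTop_eq]))).mono_left hU
    have hs := (hμ A).add hz
    rw [add_zero] at hs
    refine le_of_tendsto_of_tendsto (hμ _) hs ?_
    have hev : ∀ᶠ i : Finset G × ℕ in (U : Filter _), g ∈ i.1 :=
      hU ((eventually_ge_atTop (({g}, 0) : Finset G × ℕ)).mono fun i hi =>
        hi.1 (mem_singleton_self g))
    filter_upwards [hev] with i hi
    have hsub : F i ⊆ F i * insert 1 i.1 := fun x hx =>
      mem_mul.2 ⟨x, hx, 1, mem_insert_self _ _, mul_one x⟩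
    have h1 : #{x ∈ F i | x⁻¹ ∈ (g * ·) '' A} ≤ #{y ∈ F i * insert 1 i.1 | y⁻¹ ∈ A} := by
      refine card_le_card_of_injOn (· * g) ?_ (mul_left_injective g).injOn
      intro x hx
      obtain ⟨hx, a, ha, hax⟩ := mem_filter.1 hx
      refine mem_coe.2 (mem_filter.2 ⟨mul_mem_mul hx (mem_insert_of_mem hi), ?_⟩)
      have : (x * g)⁻¹ = a := by
        rw [mul_inv_rev, ← hax]
        simp
      rwa [this]
    have h2 : #{y ∈ F i * insert 1 i.1 | y⁻¹ ∈ A} ≤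
        #{x ∈ F i | x⁻¹ ∈ A} + #((F i * insert 1 i.1) \ F i) := by
      refine (card_le_card ?_).trans (card_union_le _ _)
      intro y hy
      simp only [mem_filter, mem_union, Finset.mem_sdiff] at hy ⊢
      tauto
    have h3 := card_sdiff_add_card_eq_card hsub
    have h4 := hF i
    have h5 : (i.2 + 1) * #((F i * insert 1 i.1) \ F i) ≤ #(F i) := by nlinarith
    have h6 : (#((F i * insert 1 i.1) \ F i) : ℝ) / #(F i) ≤ 1 / ((i.2 : ℝ) + 1) := by
      rw [div_le_div_iff₀ (hFpos i) (by positivity)]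
      have : ((i.2 : ℝ) + 1) * #((F i * insert 1 i.1) \ F i) ≤ #(F i) := by exact_mod_cast h5
      linarith
    refine le_trans ?_ (add_le_add_right h6 (m i A))
    simp only [m]
    rw [← add_div]
    gcongr
    exact_mod_cast h1.trans h2
  refine ⟨μ, fun A => ge_of_tendsto' (hμ A) fun i => (hm i A).1, ?_, ?_, ?_⟩
  · refine tendsto_nhds_unique (hμ _) (tendsto_const_nhds.congr fun i => ?_)
    simp [m, (hFpos i).ne']
  · intro A B hAB
    refine tendsto_nhds_unique (hμ _) (((hμ A).add (hμ B)).congr fun i => ?_)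
    simp only [m]
    rw [← add_div, ← Nat.cast_add, ← card_union_of_disjoint, ← filter_or]
    · simp only [Set.mem_union]
    · exact disjoint_filter.2 fun x _ hA hB => Set.disjoint_left.1 hAB hA hB
  · intro g A
    refine le_antisymm (hle g A) ?_
    have := hle g⁻¹ ((g * ·) '' A)
    rwa [Set.image_image, Set.image_congr (g := id) (by simp), Set.image_id] at this

/-! ### Moore's theorem -/

theorem evolve_congr {S : Finset G} {Q : Type*} {θ : (↥S → Q) → Q} {φ ψ : G → Q} {x : G}
    (h : ∀ s ∈ S, φ (x * s) = ψ (x * s)) : evolve S θ φ x = evolve S θ ψ x :=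
  congrArg θ (funext fun s => h s s.2)

theorem evolve_translate (S : Finset G) {Q : Type*} (θ : (↥S → Q) → Q) (φ : G → Q) (g x : G) :
    evolve S θ (fun y => φ (g * y)) x = evolve S θ φ (g * x) := by
  simp only [evolve, mul_assoc]

/-- Replacing a translated copy of one of two mutually erasable patterns by the other does not
change the evolution. -/
theorem evolve_replace [DecidableEq G] {S : Finset G} {Q : Type*} {θ : (↥S → Q) → Q}
    {φ₁ φ₂ : G → Q} (he : evolve S θ φ₁ = evolve S θ φ₂) {D : Finset G}
    (hD : ∀ x, x ∉ D → φ₁ x = φ₂ x) {M : Finset G} (hDM : D * S⁻¹ * S ⊆ M)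
    {φ : G → Q} {t : G} (ht : ∀ x ∈ M, φ (t * x) = φ₁ x) :
    evolve S θ (fun x => if t⁻¹ * x ∈ M then φ₂ (t⁻¹ * x) else φ x) = evolve S θ φ := by
  funext x
  by_cases hx : t⁻¹ * x ∈ D * S⁻¹
  · have hM : ∀ s ∈ S, t⁻¹ * (x * s) ∈ M := fun s hs => by
      rw [← mul_assoc]
      exact hDM (mul_mem_mul hx hs)
    have h1 : evolve S θ (fun x => if t⁻¹ * x ∈ M then φ₂ (t⁻¹ * x) else φ x) x
        = evolve S θ (fun y => φ₂ (t⁻¹ * y)) x :=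
      evolve_congr fun s hs => if_pos (hM s hs)
    have h2 : evolve S θ φ x = evolve S θ (fun y => φ₁ (t⁻¹ * y)) x :=
      evolve_congr fun s hs => by rw [← ht _ (hM s hs), mul_inv_cancel_left]
    rw [h1, h2, evolve_translate, evolve_translate, he]
  · refine evolve_congr fun s hs => ?_
    split_ifs with hM
    · rw [← hD, ← ht _ hM, mul_inv_cancel_left]
      intro hmem
      refine hx (mem_mul.2 ⟨_, hmem, s⁻¹, inv_mem_inv hs, ?_⟩)
      group
    · rfl

theorem exists_evolve_eq_forall_ne [DecidableEq G] {S : Finset G} {Q : Type*}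
    {θ : (↥S → Q) → Q} {φ₁ φ₂ : G → Q} (he : evolve S θ φ₁ = evolve S θ φ₂) {D : Finset G}
    (hD : ∀ x, x ∉ D → φ₁ x = φ₂ x) {M : Finset G} (hDM : D * S⁻¹ * S ⊆ M)
    (hne : ∃ x ∈ M, φ₁ x ≠ φ₂ x) (T : Finset G)
    (hT : (T : Set G).PairwiseDisjoint fun t => M.image (t * ·)) (φ : G → Q) :
    ∃ ψ : G → Q, evolve S θ ψ = evolve S θ φ ∧ ∀ t ∈ T, ∃ x ∈ M, ψ (t * x) ≠ φ₁ x := by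
  induction T using Finset.induction_on with
  | empty => exact ⟨φ, rfl, by simp⟩
  | insert t T ht ih =>
    obtain ⟨ψ, hψ, hψT⟩ := ih (hT.subset (by simp))
    by_cases hgood : ∃ x ∈ M, ψ (t * x) ≠ φ₁ x
    · exact ⟨ψ, hψ, by simpa [hgood] using hψT⟩
    push Not at hgood
    refine ⟨_, (evolve_replace he hD hDM hgood).trans hψ, fun u hu => ?_⟩
    rcases mem_insert.1 hu with rfl | hu
    · obtain ⟨x, hx, hxne⟩ := hne
      exact ⟨x, hx, by simpa [hx] using hxne.symm⟩
    · obtain ⟨x, hx, hxne⟩ := hψT u hu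
      refine ⟨x, hx, ?_⟩
      rwa [if_neg]
      intro hmem
      have hut : u ≠ t := by rintro rfl; exact ht ‹_›
      refine Finset.disjoint_left.1 (hT (by simp [hu]) (by simp) hut)
        (mem_image_of_mem (u * ·) hx) (mem_image.2 ⟨_, hmem, ?_⟩)
      exact mul_inv_cancel_left _ _

/-- A finite set contains a large subset over which the left translates of `M` are disjoint. -/
theorem exists_pairwiseDisjoint_translates [DecidableEq G] (F M : Finset G) (hM : M.Nonempty) :
    ∃ T ⊆ F, ((T : Set G).PairwiseDisjoint fun t => M.image (t * ·)) ∧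
      #F ≤ #T * (#M * #M) := by
  classical
  obtain ⟨T, hT, hmax⟩ := exists_max_image
    {T ∈ F.powerset | ((T : Finset G) : Set G).PairwiseDisjoint fun t => M.image (t * ·)} card
    ⟨∅, by simp⟩
  simp only [mem_filter, mem_powerset] at hT hmax
  refine ⟨T, hT.1, hT.2, ?_⟩
  have hcov : F ⊆ T * (M * M⁻¹) := by
    intro x hx
    by_contra hxT
    have hdis : ∀ t ∈ T, Disjoint (M.image (x * ·)) (M.image (t * ·)) := by
      intro t ht
      refine Finset.disjoint_left.2 fun y hy hy' => hxT ?_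
      obtain ⟨a, ha, rfl⟩ := mem_image.1 hy
      obtain ⟨b, hb, hab⟩ := mem_image.1 hy'
      refine mem_mul.2 ⟨t, ht, b * a⁻¹, mul_mem_mul hb (inv_mem_inv ha), ?_⟩
      rw [← mul_assoc, hab, mul_inv_cancel_right]
    have hxmem : x ∉ T := fun hmem => by
      obtain ⟨a, ha⟩ := hM
      exact Finset.disjoint_left.1 (hdis x hmem) (mem_image_of_mem _ ha) (mem_image_of_mem _ ha)
    have := hmax (insert x T) ⟨insert_subset hx hT.1, by
      rw [coe_insert]
      exact hT.2.insert fun t ht _ => hdis t ht⟩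
    rw [card_insert_of_notMem hxmem] at this
    omega
  calc #F ≤ #(T * (M * M⁻¹)) := card_le_card hcov
    _ ≤ #T * #(M * M⁻¹) := card_mul_le
    _ ≤ #T * (#M * #M) := by
      gcongr
      exact card_mul_le.trans (by rw [card_inv])

/-- Without a Garden of Eden, all patterns on `F` are images of configurations avoiding an
erasable pattern at every place of `T`; this bounds the number of patterns on `F`. -/
theorem card_pow_le_of_not_hasGOE [DecidableEq G] {S : Finset G} {Q : Type*} [Fintype Q]
    {θ : (↥S → Q) → Q} (hgoe : ¬ HasGOE S θ)
    {φ₁ φ₂ : G → Q} (he : evolve S θ φ₁ = evolve S θ φ₂) {D : Finset G}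
    (hD : ∀ x, x ∉ D → φ₁ x = φ₂ x) {M : Finset G} (hDM : D * S⁻¹ * S ⊆ M)
    (hne : ∃ x ∈ M, φ₁ x ≠ φ₂ x) {F T E : Finset G} (hFE : F * S ⊆ E)
    (hTE : T * M ⊆ E) (hT : (T : Set G).PairwiseDisjoint fun t => M.image (t * ·)) :
    Fintype.card Q ^ #F * Fintype.card Q ^ (#M * #T) ≤
      (Fintype.card Q ^ #M - 1) ^ #T * Fintype.card Q ^ #E := by
  classical
  simp only [HasGOE] at hgoe
  push Not at hgoe
  have hex : ∀ p : ↥F → Q, ∃ ψ : G → Q, (∀ y : ↥F, evolve S θ ψ y = p y) ∧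
      ∀ t ∈ T, ∃ x ∈ M, ψ (t * x) ≠ φ₁ x := by
    intro p
    obtain ⟨φ, hφ⟩ := hgoe F p
    obtain ⟨ψ, hψ, hψT⟩ := exists_evolve_eq_forall_ne he hD hDM hne T hT φ
    exact ⟨ψ, fun y => by rw [hψ, hφ], hψT⟩
  choose ψ hψ hψT using hex
  let P := {r : ↥M → Q // r ≠ fun x : ↥M => φ₁ (x : G)}
  let enc : (↥F → Q) → (↥T → P) × (↥(E \ (T * M)) → Q) := fun p =>
    (fun t => ⟨fun x => ψ p (t * x), fun hc => by
      obtain ⟨x, hx, hxne⟩ := hψT p t t.2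
      exact hxne (congrFun hc ⟨x, hx⟩)⟩, fun x => ψ p x)
  have henc : Function.Injective enc := by
    intro p p' hpp
    have h1 := (Prod.mk.inj hpp).1
    have h2 := (Prod.mk.inj hpp).2
    have hEq : ∀ x ∈ E, ψ p x = ψ p' x := by
      intro x hx
      by_cases hxT : x ∈ T * M
      · obtain ⟨t, ht, a, ha, rfl⟩ := mem_mul.1 hxT
        exact congrFun (Subtype.ext_iff.1 (congrFun h1 ⟨t, ht⟩)) ⟨a, ha⟩
      · exact congrFun h2 ⟨x, mem_sdiff.2 ⟨hx, hxT⟩⟩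
    funext y
    rw [← hψ p y, ← hψ p' y]
    exact evolve_congr fun s hs => hEq _ (hFE (mul_mem_mul y.2 hs))
  have hcard := Fintype.card_le_of_injective enc henc
  have hP : Fintype.card P = Fintype.card Q ^ #M - 1 := by
    simp only [P]
    rw [Fintype.card_subtype_compl]
    simp
  have hTM : #(T * M) = #M * #T := by
    have : T * M = T.biUnion fun t => M.image (t * ·) := by
      ext y
      simp only [Finset.mem_mul, mem_biUnion, mem_image]
    rw [this, card_biUnion hT, sum_congr rfl fun t _ =>
      card_image_of_injective M (mul_right_injective t)]
    simp [mul_comm]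
  have hsd := card_sdiff_add_card_eq_card hTE
  simp only [Fintype.card_prod, Fintype.card_fun, Fintype.card_coe, hP] at hcard
  calc Fintype.card Q ^ #F * Fintype.card Q ^ (#M * #T)
      ≤ ((Fintype.card Q ^ #M - 1) ^ #T * Fintype.card Q ^ #(E \ (T * M))) *
          Fintype.card Q ^ (#M * #T) := by gcongr
    _ = (Fintype.card Q ^ #M - 1) ^ #T * Fintype.card Q ^ #E := by
      rw [← hsd, hTM, pow_add, mul_assoc]

/-- **Moore's theorem** for amenable groups. -/
theorem IsAmenable.hasGOE_of_hasMEP (hG : IsAmenable G) {S : Finset G} {Q : Type*} [Finite Q]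
    {θ : (↥S → Q) → Q} (h : HasMEP S θ) : HasGOE S θ := by
  classical
  by_contra hgoe
  have := Fintype.ofFinite Q
  obtain ⟨φ₁, φ₂, hne, hfin, he⟩ := h
  obtain ⟨x₀, hx₀⟩ := Function.ne_iff.1 hne
  set D := hfin.toFinset with hDdef
  have hD : ∀ x, x ∉ D → φ₁ x = φ₂ x := fun x hx => by simpa [hDdef] using hx
  set M := D ∪ D * S⁻¹ * S
  have hx₀M : x₀ ∈ M := mem_union_left _ (by simpa [hDdef] using hx₀)
  have hMpos : 0 < #M := card_pos.2 ⟨x₀, hx₀M⟩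
  set q := Fintype.card Q with hq
  have hqpos : 0 < q := Fintype.card_pos_iff.2 ⟨φ₁ x₀⟩
  obtain ⟨a, ha⟩ : ∃ a, q ^ #M = a + 1 :=
    ⟨q ^ #M - 1, (Nat.sub_add_cancel (Nat.pow_pos hqpos)).symm⟩
  obtain ⟨N, hN⟩ := exists_mul_pow_lt_succ_pow q a
  obtain ⟨F, hFne, hF⟩ := exists_folner_of_not_doubling hG.not_doubling
    (insert 1 (S ∪ M)) (N * (#M * #M))
  set E := F * insert 1 (S ∪ M)
  obtain ⟨T, hTF, hT, hFT⟩ := exists_pairwiseDisjoint_translates F M ⟨x₀, hx₀M⟩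
  have hFE : F ⊆ E := fun x hx => mem_mul.2 ⟨x, hx, 1, mem_insert_self _ _, mul_one x⟩
  have hcount := card_pow_le_of_not_hasGOE hgoe he hD (M := M) subset_union_right
    ⟨x₀, hx₀M, hx₀⟩ (E := E)
    (mul_subset_mul_left (subset_union_left.trans (subset_insert _ _)))
    (mul_subset_mul hTF (subset_union_right.trans (subset_insert _ _))) hT
  rw [← hq, pow_mul, ha, Nat.add_sub_cancel] at hcount
  obtain ⟨e, hE⟩ := Nat.exists_eq_add_of_le (card_le_card hFE)
  have hTpos : 0 < #T := by
    have := hFne.card_pos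
    by_contra! h0
    simp only [nonpos_iff_eq_zero.1 h0] at hFT
    omega
  have hNe : N * e ≤ #T := by
    rw [hE] at hF
    have h1 : N * (#M * #M) * e < #T * (#M * #M) := by nlinarith
    have h2 : (#M * #M) * (N * e) < (#M * #M) * #T := by linarith
    exact (lt_of_mul_lt_mul_left h2 (Nat.zero_le _)).le
  have hstep : (a + 1) ^ #T ≤ a ^ #T * q ^ e := by
    rw [hE, pow_add] at hcount
    refine le_of_mul_le_mul_left ?_ (Nat.pow_pos (n := #F) hqpos)
    linarith
  have hcontra : ((a + 1) ^ N) ^ #T ≤ (q * a ^ N) ^ #T :=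
    calc ((a + 1) ^ N) ^ #T = ((a + 1) ^ #T) ^ N := by rw [← pow_mul, ← pow_mul, mul_comm]
      _ ≤ (a ^ #T * q ^ e) ^ N := by gcongr
      _ = (a ^ N) ^ #T * q ^ (N * e) := by
        rw [mul_pow, ← pow_mul, ← pow_mul, ← pow_mul, mul_comm N, mul_comm N]
      _ ≤ (a ^ N) ^ #T * q ^ #T := by gcongr
      _ = (q * a ^ N) ^ #T := by rw [mul_pow, mul_comm]
  exact absurd hcontra (not_le.2 (Nat.pow_lt_pow_left hN hTpos.ne'))

/-! ### Non-amenable groups -/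

open Classical in
/-- A cell with state `(p, d)` offers its data `d` to at most one cell: if `p = some (e s, b)`,
to the cell lying at displacement `s⁻¹`, as the `b`-th half of its next state. The automaton
assembles the new state of a cell from the two halves offered to it. -/
noncomputable def pointerRule {S ι : Type*} (e : S → ι)
    (c : S → Option (ι × Bool) × Option (ι × Bool)) : Option (ι × Bool) × Option (ι × Bool) :=
  let half : Bool → Option (ι × Bool) := fun b =>
    if h : ∃ s, (c s).1 = some (e s, b) then (c h.choose).2 else none
  (half true, half false)

theorem pointerRule_eq {S ι : Type*} {e : S → ι}
    {c : S → Option (ι × Bool) × Option (ι × Bool)} {d : Bool → Option (ι × Bool)}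
    (hex : ∀ b, ∃ s, (c s).1 = some (e s, b))
    (hd : ∀ b s, (c s).1 = some (e s, b) → (c s).2 = d b) :
    pointerRule e c = (d true, d false) := by
  simp only [pointerRule, dif_pos (hex _)]
  rw [hd true _ (hex true).choose_spec, hd false _ (hex false).choose_spec]

theorem pointerRule_eq_none {S ι : Type*} {e : S → ι}
    {c : S → Option (ι × Bool) × Option (ι × Bool)} (h : ∀ s, (c s).1 = none) :
    pointerRule e c = (none, none) := by
  simp [pointerRule, h]

theorem hasMEP_pointerRule {S : Finset G} {ι : Type*} [Nonempty ι] (e : ↥S → ι) :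
    HasMEP S (pointerRule e) := by
  classical
  obtain ⟨i⟩ := ‹Nonempty ι›
  refine ⟨fun _ => (none, none), fun x => (none, if x = 1 then some (i, true) else none), ?_,
    (Set.finite_singleton (1 : G)).subset ?_, ?_⟩
  · intro h
    simpa using congrFun h 1
  · intro x hx
    by_contra h1
    simp only [Set.mem_singleton_iff] at h1
    simp [h1] at hx
  · funext x
    exact (pointerRule_eq_none fun _ => rfl).trans (pointerRule_eq_none fun _ => rfl).symm

theorem evolve_pointerRule_surjective {S : Finset G} {ι : Type*} {e : ↥S → ι}
    (he : Function.Injective e) {f : G × Bool → G} (hf : Function.Injective f)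
    (hfS : ∀ p, ∃ s ∈ S, f p = p.1 * s) : Function.Surjective (evolve S (pointerRule e)) := by
  classical
  choose d hdS hd using hfS
  intro ψ
  let val : G × Bool → Option (ι × Bool) × Option (ι × Bool) := fun p =>
    (some (e ⟨d p, hdS p⟩, p.2), if p.2 then (ψ p.1).1 else (ψ p.1).2)
  let φ := Function.extend f val fun _ => (none, none)
  have hφ : ∀ p, φ (f p) = val p := hf.extend_apply val _
  refine ⟨φ, funext fun x => ?_⟩
  refine (pointerRule_eq (d := fun b => if b then (ψ x).1 else (ψ x).2) ?_ ?_).trans (by simp)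
  · intro b
    refine ⟨⟨d (x, b), hdS (x, b)⟩, ?_⟩
    have := hd (x, b)
    simp only at this ⊢
    rw [← this, hφ]
  · intro b s hs
    by_cases hr : ∃ p, f p = x * s
    · obtain ⟨p, hp⟩ := hr
      simp only [← hp, hφ, val, Option.some.injEq, Prod.mk.injEq] at hs ⊢
      obtain ⟨hs1, rfl⟩ := hs
      have hds : d p = s := congrArg Subtype.val (he hs1)
      rw [hd p, hds] at hp
      rw [mul_right_cancel hp]
    · simp [φ, Function.extend_apply' _ _ _ hr] at hs

end Helpers

/-- A converse to Moore's theorem: a group `G` is amenable if and only if every finite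
cellular automaton on `G` admitting mutually erasable patterns admits a garden of Eden. -/
theorem amenable_iff_moore (G : Type*) [Group G] :
    IsAmenable G ↔
      ∀ (S : Finset G) (Q : Type) (_ : Finite Q) (θ : (↥S → Q) → Q),
        HasMEP S θ → HasGOE S θ := by
  classical
  refine ⟨fun hG S Q _ θ => hG.hasGOE_of_hasMEP, fun h => ?_⟩
  by_contra hG
  obtain ⟨K, hK⟩ := not_not.1 (mt isAmenable_of_not_doubling hG)
  obtain ⟨f, hf, hfK⟩ := exists_injective_of_doubling hK
  have : Nonempty (Fin K.card) := by
    obtain ⟨s, hs, -⟩ := hfK (1, true)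
    exact ⟨K.equivFin ⟨s, hs⟩⟩
  obtain ⟨Y, p, hYp⟩ := h K _ inferInstance _ (hasMEP_pointerRule K.equivFin)
  have hsurj := evolve_pointerRule_surjective K.equivFin.injective hf hfK
  obtain ⟨φ, hφ⟩ := hsurj fun x => if hx : x ∈ Y then p ⟨x, hx⟩ else (none, none)
  obtain ⟨y, hy⟩ := hYp φ
  exact hy (by simp [hφ])
end

section
/- Let G be a non-amenable group. Then there exists a finite subset S ⊆ G, a finite set Q, and a cellular automaton θ: Q^S → Q that admits mutually erasable patterns but admits no garden of Eden. -/
variable {G : Type*} [Group G]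

open Filter Topology Pointwise

/-- The proportion of elements of `F` whose inverse lies in `A`. -/
noncomputable def invDensity (F : Finset G) (A : Set G) : ℝ :=
  ((F : Set G) ∩ A⁻¹).ncard / F.card

theorem invDensity_nonneg (F : Finset G) (A : Set G) : 0 ≤ invDensity F A := by
  unfold invDensity; positivity

theorem invDensity_le_one (F : Finset G) (A : Set G) : invDensity F A ≤ 1 := by
  refine div_le_one_of_le₀ ?_ (by positivity)
  rw [← Set.ncard_coe_finset]
  exact_mod_cast Set.ncard_le_ncard Set.inter_subset_left F.finite_toSet

theorem invDensity_univ {F : Finset G} (hF : F.Nonempty) : invDensity F Set.univ = 1 := by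
  have : (F.card : ℝ) ≠ 0 := by simpa using hF.ne_empty
  simp [invDensity, this]

theorem invDensity_union (F : Finset G) {A B : Set G} (h : Disjoint A B) :
    invDensity F (A ∪ B) = invDensity F A + invDensity F B := by
  have hd : Disjoint ((F : Set G) ∩ A⁻¹) (F ∩ B⁻¹) :=
    (h.preimage _).mono Set.inter_subset_right Set.inter_subset_right
  rw [invDensity, invDensity, invDensity, Set.union_inv, Set.inter_union_distrib_left,
    Set.ncard_union_eq hd (F.finite_toSet.inter_of_left _) (F.finite_toSet.inter_of_left _)]
  push_cast
  ring

/-- If right multiplication by `K` enlarges `F` only slightly, then `invDensity F` is almost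
invariant under left translation by elements of `K`. -/
theorem invDensity_image_mul_left_le [DecidableEq G] {F K : Finset G} {ε : ℝ} (hF : F.Nonempty)
    (h1 : 1 ∈ K) (hFK : ((F * K).card : ℝ) ≤ (1 + ε) * F.card) {g : G} (hg : g ∈ K) (A : Set G) :
    invDensity F ((g * ·) '' A) ≤ invDensity F A + ε := by
  have hpos : (0 : ℝ) < F.card := by exact_mod_cast hF.card_pos
  have hsub : F ⊆ F * K := fun x hx => by simpa using Finset.mul_mem_mul hx h1
  have hcard : ((F : Set G) ∩ ((g * ·) '' A)⁻¹).ncard ≤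
      ((F : Set G) ∩ A⁻¹).ncard + ((F * K) \ F).card := by
    rw [← Set.ncard_image_of_injective _ (mul_left_injective g), ← Set.ncard_coe_finset]
    refine (Set.ncard_le_ncard ?_ ((F.finite_toSet.inter_of_left _).union
      (Finset.finite_toSet _))).trans (Set.ncard_union_le _ _)
    rintro _ ⟨x, ⟨hxF, a, ha, hax⟩, rfl⟩
    have hxg : (x * g)⁻¹ = a := by
      have : g * a = x⁻¹ := hax
      rw [mul_inv_rev, ← this, inv_mul_cancel_left]
    by_cases hm : x * g ∈ F
    · exact Or.inl ⟨hm, show (x * g)⁻¹ ∈ A from hxg.symm ▸ ha⟩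
    · exact Or.inr (Finset.mem_coe.2 (Finset.mem_sdiff.2 ⟨Finset.mul_mem_mul hxF hg, hm⟩))
  have hdiff : (((F * K) \ F).card : ℝ) ≤ ε * F.card := by
    rw [Finset.cast_card_sdiff hsub]
    linarith
  rw [invDensity, invDensity, div_add' _ _ _ hpos.ne', div_le_div_iff_of_pos_right hpos]
  have : ((((F : Set G) ∩ ((g * ·) '' A)⁻¹).ncard : ℕ) : ℝ) ≤
      ((F : Set G) ∩ A⁻¹).ncard + ((F * K) \ F).card := by exact_mod_cast hcard
  linarith

/-- Følner's condition implies amenability. -/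
theorem isAmenable_of_foelner [DecidableEq G]
    (h : ∀ (K : Finset G) (n : ℕ), ∃ F : Finset G, F.Nonempty ∧
      ((F * K).card : ℝ) ≤ (1 + 1 / ((n : ℝ) + 1)) * F.card) : IsAmenable G := by
  choose F hne hF using fun i : Finset G × ℕ => h (insert 1 i.1) i.2
  let U : Ultrafilter (Finset G × ℕ) := Ultrafilter.of atTop
  have hU : (U : Filter (Finset G × ℕ)) ≤ atTop := Ultrafilter.of_le _
  have hlim (A : Set G) : ∃ r : ℝ, Tendsto (fun i => invDensity (F i) A) U (𝓝 r) := by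
    obtain ⟨r, -, hr⟩ := (isCompact_Icc (a := (0 : ℝ)) (b := 1)).ultrafilter_le_nhds
      (U.map fun i => invDensity (F i) A)
      (by
        rw [le_principal_iff]
        exact mem_map.2 (univ_mem' fun i => ⟨invDensity_nonneg _ _, invDensity_le_one _ _⟩))
    exact ⟨r, hr⟩
  choose μ hμ using hlim
  have hle (g : G) (A : Set G) : μ ((g * ·) '' A) ≤ μ A := by
    have hε : Tendsto (fun i : Finset G × ℕ => 1 / ((i.2 : ℝ) + 1)) U (𝓝 0) :=
      (tendsto_one_div_add_atTop_nhds_zero_nat.comp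
        (tendsto_snd.mono_left prod_atTop_atTop_eq.ge)).mono_left hU
    have hsum := (hμ A).add hε
    rw [add_zero] at hsum
    refine le_of_tendsto_of_tendsto (hμ _) hsum ?_
    filter_upwards [hU (Ici_mem_atTop (({g} : Finset G), 0))] with i hi
    refine invDensity_image_mul_left_le (hne i) (Finset.mem_insert_self _ _) (hF i) ?_ A
    exact Finset.mem_insert_of_mem (hi.1 (Finset.mem_singleton_self g))
  refine ⟨μ, fun A => ge_of_tendsto' (hμ A) fun i => invDensity_nonneg _ _, ?_, ?_, ?_⟩
  · exact tendsto_nhds_unique (hμ _)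
      (tendsto_const_nhds.congr fun i => (invDensity_univ (hne i)).symm)
  · intro A B hAB
    exact tendsto_nhds_unique (hμ _)
      (((hμ A).add (hμ B)).congr fun i => (invDensity_union (F i) hAB).symm)
  · intro g A
    refine (hle g A).antisymm ?_
    simpa only [Set.image_image, inv_mul_cancel_left, Set.image_id'] using hle g⁻¹ ((g * ·) '' A)

/-- In a non-amenable group, some finite set `S` satisfies `2 |F| ≤ |F S|` for all finite `F`. -/
theorem exists_doubling_of_not_isAmenable [DecidableEq G] (hG : ¬ IsAmenable G) :
    ∃ S : Finset G, ∀ F : Finset G, 2 * F.card ≤ (F * S).card := by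
  have hn : ∃ (K : Finset G) (n : ℕ), ∀ F : Finset G, F.Nonempty →
      (1 + 1 / ((n : ℝ) + 1)) * F.card < (F * K).card := by
    by_contra! hcon
    exact hG (isAmenable_of_foelner hcon)
  obtain ⟨K, n, hK⟩ := hn
  set c : ℝ := 1 + 1 / ((n : ℝ) + 1)
  have hc : 1 < c := lt_add_of_pos_right _ (by positivity)
  have hpow (m : ℕ) (F : Finset G) : c ^ m * F.card ≤ (F * K ^ m).card := by
    induction m with
    | zero => simp
    | succ m ih =>
      rw [pow_succ K, ← mul_assoc F, pow_succ', mul_assoc]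
      refine (mul_le_mul_of_nonneg_left ih (by linarith)).trans ?_
      rcases (F * K ^ m).eq_empty_or_nonempty with h | h
      · simp [h]
      · exact (hK _ h).le
  obtain ⟨m, hm⟩ := pow_unbounded_of_one_lt 2 hc
  refine ⟨K ^ m, fun F => ?_⟩
  have := (mul_le_mul_of_nonneg_right hm.le (Nat.cast_nonneg F.card)).trans (hpow m F)
  exact_mod_cast this

/-- A non-amenable group carries a vector field `c` of bounded length such that the map
`g ↦ g * (c g)⁻¹` is everywhere at least two-to-one. -/
theorem exists_compressing_of_not_isAmenable (hG : ¬ IsAmenable G) :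
    ∃ (S : Finset G) (c : G → S), ∀ x : G, {s : S | c (x * s) = s}.Nontrivial := by
  classical
  obtain ⟨S, hS⟩ := exists_doubling_of_not_isAmenable hG
  obtain ⟨h, hinj, hmem⟩ := (Finset.all_card_le_biUnion_card_iff_exists_injective
    (fun p : G × Bool => ({p.1} : Finset G) * S)).1 fun P => by
      have hsub : P ⊆ P.image Prod.fst ×ˢ Finset.univ := fun p hp =>
        Finset.mem_product.2 ⟨Finset.mem_image_of_mem _ hp, Finset.mem_univ _⟩
      have hcard := Finset.card_le_card hsub
      rw [Finset.card_product, Finset.card_univ, Fintype.card_bool, mul_comm] at hcard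
      refine (hcard.trans (hS _)).trans (Finset.card_le_card ?_)
      intro y hy
      obtain ⟨x, hx, s, hs, rfl⟩ := Finset.mem_mul.1 hy
      obtain ⟨p, hp, rfl⟩ := Finset.mem_image.1 hx
      exact Finset.mem_biUnion.2
        ⟨p, hp, Finset.mul_mem_mul (Finset.mem_singleton_self _) hs⟩
  have hmem' (p : G × Bool) : p.1⁻¹ * h p ∈ S := by
    obtain ⟨x, hx, s, hs, hsp⟩ := Finset.mem_mul.1 (hmem p)
    simpa [← hsp, Finset.mem_singleton.1 hx] using hs
  let d (p : G × Bool) : S := ⟨p.1⁻¹ * h p, hmem' p⟩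
  have hd (p : G × Bool) : p.1 * (d p : G) = h p := mul_inv_cancel_left _ _
  refine ⟨S, Function.extend h d fun _ => d (1, true), fun x => ?_⟩
  have hfix (b : Bool) : Function.extend h d (fun _ => d (1, true)) (x * d (x, b)) = d (x, b) := by
    rw [hd (x, b), hinj.extend_apply]
  refine ⟨d (x, true), hfix true, d (x, false), hfix false, fun heq => ?_⟩
  have := hinj ((hd (x, true)).symm.trans ((congrArg (fun s : S => x * (s : G)) heq).trans
    (hd (x, false))))
  simp at this

/-- A surjective evolution has no Garden of Eden. -/
theorem not_hasGOE_of_surjective {S : Finset G} {Q : Type*} [Nonempty Q] {θ : (↥S → Q) → Q}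
    (h : Function.Surjective (evolve S θ)) : ¬ HasGOE S θ := by
  rintro ⟨Y, p, hp⟩
  obtain ⟨φ, hφ⟩ := h (Function.extend Subtype.val p fun _ => Classical.arbitrary Q)
  obtain ⟨y, hy⟩ := hp φ
  exact hy (by rw [hφ, Subtype.val_injective.extend_apply])

/-- On a non-amenable group there is a finite cellular automaton admitting mutually
erasable patterns but no garden of Eden. -/
theorem exists_mep_without_goe (G : Type*) [Group G] (hG : ¬ IsAmenable G) :
    ∃ (S : Finset G) (Q : Type) (_ : Finite Q) (θ : (↥S → Q) → Q),
      HasMEP S θ ∧ ¬ HasGOE S θ := by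
  classical
  obtain ⟨S, c, hc⟩ := exists_compressing_of_not_isAmenable hG
  have hpick : ∃ a b : Set S → S, ∀ T : Set S, T.Nontrivial → a T ∈ T ∧ b T ∈ T ∧ a T ≠ b T := by
    have (T : Set S) : ∃ a b : S, T.Nontrivial → a ∈ T ∧ b ∈ T ∧ a ≠ b := by
      by_cases hT : T.Nontrivial
      · obtain ⟨a, ha, b, hb, hab⟩ := hT
        exact ⟨a, b, fun _ => ⟨ha, hb, hab⟩⟩
      · exact ⟨c 1, c 1, fun h => absurd h hT⟩
    choose a b hab using this
    exact ⟨a, b, hab⟩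
  obtain ⟨a, b, hab⟩ := hpick
  let e := S.equivFin
  let Q := Fin S.card × Bool × Fin S.card
  let T (v : S → Q) : Set S := {s | (v s).1 = e s}
  let θ : (S → Q) → Q := fun v =>
    ((v (a (T v))).2.2, (v (a (T v))).2.1, (v (b (T v))).2.2)
  let C (x : G) : Set S := {s | c (x * s) = s}
  have hT (φ : G → Q) (hφ : ∀ g, (φ g).1 = e (c g)) (x : G) :
      T (fun s => φ (x * s)) = C x := by
    ext s
    simp [T, C, hφ]
  have hevolve (φ : G → Q) (hφ : ∀ g, (φ g).1 = e (c g)) (x : G) : evolve S θ φ x =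
      ((φ (x * a (C x))).2.2, (φ (x * a (C x))).2.1, (φ (x * b (C x))).2.2) := by
    simp only [evolve, θ, hT φ hφ]
  refine ⟨S, Q, inferInstance, θ, ?_, ?_⟩
  · let φ (t : G → Bool) (g : G) : Q := (e (c g), t g, e (c g))
    let g₀ : G := b (C 1)
    refine ⟨φ fun _ => false, φ fun g => decide (g = g₀), fun heq => ?_, ?_, ?_⟩
    · simpa [φ] using congrArg (fun q : Q => q.2.1) (congrFun heq g₀)
    · refine (Set.finite_singleton g₀).subset fun g hg => ?_
      by_contra hne
      exact hg (by simp [φ, show g ≠ g₀ from hne])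
    · funext x
      rw [hevolve _ (fun _ => rfl), hevolve _ (fun _ => rfl)]
      obtain ⟨ha, -, hne⟩ := hab _ (hc x)
      obtain ⟨-, hb, -⟩ := hab _ (hc 1)
      have hx : x * a (C x) ≠ g₀ := by
        intro h
        have hcb : c g₀ = b (C 1) := by simpa [g₀, C] using hb
        have hca : c g₀ = a (C x) := h ▸ ha
        have heq : a (C x) = b (C 1) := hca.symm.trans hcb
        have hx1 : x = 1 := by simpa [heq, g₀] using h
        subst hx1
        exact hne heq
      simp [φ, hx]
  · have : Nonempty Q := ⟨(e (c 1), false, e (c 1))⟩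
    refine not_hasGOE_of_surjective fun ψ => ?_
    let f (g : G) : G := g * (c g : G)⁻¹
    refine ⟨fun g => (e (c g), (ψ (f g)).2.1,
      if c g = a (C (f g)) then (ψ (f g)).1 else (ψ (f g)).2.2), ?_⟩
    funext x
    rw [hevolve _ (fun _ => rfl)]
    obtain ⟨ha, hb, hne⟩ := hab _ (hc x)
    have ha' : c (x * a (C x)) = a (C x) := ha
    have hb' : c (x * b (C x)) = b (C x) := hb
    have hfa : f (x * a (C x)) = x := by simp [f, ha']
    have hfb : f (x * b (C x)) = x := by simp [f, hb']
    have hne' : b (C x) ≠ a (C x) := hne.symm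
    simp only [hfa, hfb, ha', hb', if_true, if_neg hne']
    rfl
end

section
/- Let G be a group, S a finite subset of G, and suppose there exist natural numbers m > n and an m:n compressing correspondence on G with propagation S. Then G is not amenable. -/
/-- An `m:n` compressing correspondence on `G` with propagation `S`: a function
`f : G × G → ℕ` whose "column" sums are `m`, whose "row" sums are `n`, and which is
supported on pairs `(x, y)` with `y ∈ xS`. -/
def IsCompressingCorrespondence {G : Type*} [Group G] (S : Finset G) (m n : ℕ)
    (f : G × G → ℕ) : Prop :=
  (∀ y : G, ∑ᶠ x : G, f (x, y) = m) ∧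
  (∀ x : G, ∑ᶠ y : G, f (x, y) = n) ∧
  (∀ x y : G, f (x, y) ≠ 0 → ∃ s ∈ S, y = x * s)

/-- A finitely additive set function is a sum over the fibres of any map to a finite type. -/
theorem finitelyAdditive_eq_sum_fibres {X P : Type*} [Fintype P] {ν : Set X → ℝ}
    (hν : ∀ A B : Set X, Disjoint A B → ν (A ∪ B) = ν A + ν B) (F : X → P) (A : Set X) :
    ν A = ∑ p, ν (A ∩ F ⁻¹' {p}) := by
  classical
  have h_empty : ν ∅ = 0 := by
    have h := hν ∅ ∅ disjoint_bot_left
    rw [Set.union_self] at h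
    linarith
  have key (T : Finset P) : ν (A ∩ F ⁻¹' T) = ∑ p ∈ T, ν (A ∩ F ⁻¹' {p}) := by
    induction T using Finset.induction_on with
    | empty => simp [h_empty]
    | insert a T ha ih =>
      rw [Finset.sum_insert ha, ← ih, ← hν]
      · congr 1
        ext x
        simp only [Finset.coe_insert, Set.mem_inter_iff, Set.mem_preimage, Set.mem_insert_iff,
          Finset.mem_coe, Set.mem_union, Set.mem_singleton_iff]
        tauto
      · rw [Set.disjoint_left]
        rintro x ⟨_, hx⟩ ⟨_, hx'⟩
        rw [Set.mem_preimage, Set.mem_singleton_iff] at hx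
        rw [Set.mem_preimage, hx] at hx'
        exact ha hx'
  simpa using key Finset.univ

/-- If finitely many functions with values in `{0, …, N - 1}` add up to the constant `c`, then
so do their integrals against a finitely additive probability measure. -/
theorem sum_integral_eq_of_sum_eq {X ι : Type*} [Fintype ι] {N : ℕ} {ν : Set X → ℝ}
    (hν : ∀ A B : Set X, Disjoint A B → ν (A ∪ B) = ν A + ν B) (h_univ : ν Set.univ = 1)
    (h : ι → X → Fin N) (c : ℕ) (hc : ∀ x, ∑ i, (h i x : ℕ) = c) :
    ∑ i, ∑ k : Fin N, ((k : ℕ) : ℝ) * ν (h i ⁻¹' {k}) = c := by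
  classical
  have h_empty : ν ∅ = 0 := by
    have h := hν ∅ ∅ disjoint_bot_left
    rw [Set.union_self] at h
    linarith
  let F : X → ι → Fin N := fun x i => h i x
  have h_inter (i : ι) (k : Fin N) (p : ι → Fin N) :
      ν (h i ⁻¹' {k} ∩ F ⁻¹' {p}) = if p i = k then ν (F ⁻¹' {p}) else 0 := by
    split_ifs with hk
    · congr 1
      refine Set.inter_eq_right.2 fun x hx => ?_
      exact (congrFun hx i).trans hk
    · rw [← h_empty]
      congr 1
      refine Set.eq_empty_of_forall_notMem fun x hx => hk ?_
      exact (congrFun hx.2 i).symm.trans hx.1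
  have h_fibre (p : ι → Fin N) :
      ∑ i, ((p i : ℕ) : ℝ) * ν (F ⁻¹' {p}) = c * ν (F ⁻¹' {p}) := by
    rcases (F ⁻¹' {p}).eq_empty_or_nonempty with he | ⟨x, hx⟩
    · simp [he, h_empty]
    · have hp : F x = p := hx
      rw [← Finset.sum_mul, ← hc x, ← hp]
      push_cast
      rfl
  calc ∑ i, ∑ k : Fin N, ((k : ℕ) : ℝ) * ν (h i ⁻¹' {k})
      = ∑ i, ∑ p : ι → Fin N, ((p i : ℕ) : ℝ) * ν (F ⁻¹' {p}) := by
        refine Finset.sum_congr rfl fun i _ => ?_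
        simp_rw [finitelyAdditive_eq_sum_fibres hν F (h i ⁻¹' _), h_inter, Finset.mul_sum]
        rw [Finset.sum_comm]
        simp
    _ = ∑ p : ι → Fin N, c * ν (F ⁻¹' {p}) := by
        rw [Finset.sum_comm]
        exact Finset.sum_congr rfl fun p _ => h_fibre p
    _ = c := by
        rw [← Finset.mul_sum]
        have := finitelyAdditive_eq_sum_fibres hν F Set.univ
        simp only [Set.univ_inter] at this
        rw [← this, h_univ, mul_one]

/-- An amenable group carries a right-invariant finitely additive probability measure. -/
theorem IsAmenable.exists_right_invariant {G : Type*} [Group G] (hG : IsAmenable G) :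
    ∃ ν : Set G → ℝ, ν Set.univ = 1 ∧
      (∀ A B : Set G, Disjoint A B → ν (A ∪ B) = ν A + ν B) ∧
      ∀ (g : G) (A : Set G), ν ((· * g) ⁻¹' A) = ν A := by
  obtain ⟨μ, -, h_univ, h_add, h_inv⟩ := hG
  refine ⟨fun A => μ (Inv.inv ⁻¹' A), by simpa using h_univ, fun A B hAB => ?_, fun g A => ?_⟩
  · exact h_add _ _ (hAB.preimage _)
  · change μ _ = μ _
    rw [← h_inv g (Inv.inv ⁻¹' A)]
    congr 1
    ext x
    simp

namespace IsCompressingCorrespondence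

variable {G : Type*} [Group G] {S : Finset G} {m n : ℕ} {f : G × G → ℕ}

theorem sum_row (hf : IsCompressingCorrespondence S m n f) (x : G) :
    ∑ s : S, f (x, x * s) = n := by
  rw [← hf.2.1 x, ← finsum_comp_equiv (Equiv.mulLeft x),
    Finset.sum_coe_sort S fun s => f (x, x * s)]
  refine (finsum_eq_sum_of_support_subset _ fun s hs => ?_).symm
  obtain ⟨t, ht, h⟩ := hf.2.2 _ _ hs
  exact (mul_left_cancel h : s = t) ▸ ht

theorem sum_column (hf : IsCompressingCorrespondence S m n f) (y : G) :
    ∑ s : S, f (y * (s : G)⁻¹, y) = m := by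
  rw [← hf.1 y, ← finsum_comp_equiv ((Equiv.inv G).trans (Equiv.mulLeft y)),
    Finset.sum_coe_sort S fun s => f (y * s⁻¹, y)]
  refine (finsum_eq_sum_of_support_subset _ fun s hs => ?_).symm
  obtain ⟨t, ht, h⟩ := hf.2.2 _ _ hs
  have hst : s = t := by
    simpa [mul_assoc, inv_mul_eq_one] using h
  exact hst ▸ ht

theorem apply_le (hf : IsCompressingCorrespondence S m n f) (x : G) (s : S) :
    f (x, x * s) ≤ n :=
  hf.sum_row x ▸ Finset.single_le_sum (f := fun s : S => f (x, x * s))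
    (fun _ _ => Nat.zero_le _) (Finset.mem_univ s)

end IsCompressingCorrespondence

/-- If a group admits an `m:n` compressing correspondence with `m > n` and finite
propagation, then it is not amenable. -/
theorem not_amenable_of_compressing_correspondence (G : Type*) [Group G]
    (S : Finset G) (m n : ℕ) (hmn : n < m) (f : G × G → ℕ)
    (hf : IsCompressingCorrespondence S m n f) :
    ¬ IsAmenable G := by
  intro hG
  obtain ⟨ν, h_univ, h_add, h_inv⟩ := hG.exists_right_invariant
  let h : S → G → Fin (n + 1) := fun s x => ⟨f (x, x * s), Nat.lt_succ_of_le (hf.apply_le x s)⟩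
  have h_row := sum_integral_eq_of_sum_eq h_add h_univ h n hf.sum_row
  have h_column := sum_integral_eq_of_sum_eq h_add h_univ
    (fun s y => h s (y * (s : G)⁻¹)) m fun y => by simpa [h] using hf.sum_column y
  have h_eq (s : S) (k : Fin (n + 1)) :
      ν ((fun y => h s (y * (s : G)⁻¹)) ⁻¹' {k}) = ν (h s ⁻¹' {k}) :=
    h_inv (s : G)⁻¹ (h s ⁻¹' {k})
  simp only [h_eq] at h_column
  exact hmn.ne (Nat.cast_injective (h_row.symm.trans h_column))
end

section
/- Let G be a non-amenable group. Then there exists a finite subset S of G and a bounded-propagation 2:1 compressing vector field on G, i.e. a map f: G → G such that f(x)⁻¹·x ∈ S for all x ∈ G and the preimage f⁻¹(x) has exactly two elements for all x ∈ G. -/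
open Filter Topology
open scoped Pointwise

/-- A group in which some nonempty finite set is almost invariant under right multiplication by
any prescribed finite set is amenable: the mean is a limit of the uniform measures on the inverses
of the almost invariant sets. -/
theorem isAmenable_of_exists_card_mul_le {G : Type*} [Group G] [DecidableEq G]
    (h : ∀ (K : Finset G) (n : ℕ), ∃ F : Finset G, F.Nonempty ∧
      n * (F * K).card ≤ (n + 1) * F.card) :
    IsAmenable G := by
  classical
  choose F hF hFK using fun p : Finset G × ℕ => h (insert 1 p.1) p.2
  let U : Ultrafilter (Finset G × ℕ) := Ultrafilter.of atTop
  have hU : (U : Filter (Finset G × ℕ)) ≤ atTop := Ultrafilter.of_le _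
  let φ : Finset G × ℕ → Set G → ℝ := fun p A => (((F p).filter (·⁻¹ ∈ A)).card : ℝ) / (F p).card
  have hpos (p) : (0 : ℝ) < (F p).card := by exact_mod_cast (hF p).card_pos
  have hφ (p A) : φ p A ∈ Set.Icc (0 : ℝ) 1 :=
    ⟨by positivity, div_le_one_of_le₀ (by exact_mod_cast Finset.card_filter_le _ _) (hpos p).le⟩
  obtain ⟨μ, -, hμ⟩ := (isCompact_univ_pi fun _ : Set G => isCompact_Icc (a := (0 : ℝ)) (b := 1))
    |>.ultrafilter_le_nhds (U.map φ)
      (tendsto_principal.2 (Eventually.of_forall fun p A _ => hφ p A))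
  have hlim (A : Set G) : Tendsto (fun p => φ p A) U (𝓝 (μ A)) :=
    tendsto_pi_nhds.1 hμ A
  have hle (g : G) (A : Set G) : μ ((g * ·) '' A) ≤ μ A := by
    have hn : Tendsto (fun p : Finset G × ℕ => 1 / (p.2 : ℝ)) U (𝓝 0) :=
      (tendsto_one_div_atTop_nhds_zero_nat.comp
        (tendsto_snd.mono_left prod_atTop_atTop_eq.ge)).mono_left hU
    have hev : ∀ᶠ p : Finset G × ℕ in U, ({g}, 1) ≤ p := hU (eventually_ge_atTop _)
    refine le_of_tendsto_of_tendsto (hlim _) (add_zero (μ A) ▸ (hlim A).add hn) ?_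
    filter_upwards [hev] with p hp
    have hg : g ∈ p.1 := by simpa using hp.1
    have hn1 : (0 : ℝ) < p.2 := by exact_mod_cast hp.2
    have hcard : ((F p).filter (·⁻¹ ∈ (g * ·) '' A)).card + (F p).card ≤
        ((F p).filter (·⁻¹ ∈ A)).card + (F p * insert 1 p.1).card := by
      rw [← Finset.card_image_of_injective _ (mul_left_injective g),
        ← Finset.card_union_add_card_inter, add_comm]
      refine add_le_add (Finset.card_le_card fun x hx => ?_) (Finset.card_le_card fun x hx => ?_)
      · obtain ⟨hx, hxF⟩ := Finset.mem_inter.1 hx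
        obtain ⟨y, hy, rfl⟩ := Finset.mem_image.1 hx
        obtain ⟨a, ha, hya⟩ := (Finset.mem_filter.1 hy).2
        have : (y * g)⁻¹ = a := by simp [← hya]
        exact Finset.mem_filter.2 ⟨hxF, this ▸ ha⟩
      · rcases Finset.mem_union.1 hx with hx | hx
        · obtain ⟨y, hy, rfl⟩ := Finset.mem_image.1 hx
          exact Finset.mul_mem_mul (Finset.mem_filter.1 hy).1 (Finset.mem_insert_of_mem hg)
        · simpa using Finset.mul_mem_mul hx (Finset.mem_insert_self 1 p.1)
    have hK : (p.2 : ℝ) * (F p * insert 1 p.1).card ≤ (p.2 + 1) * (F p).card := by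
      exact_mod_cast hFK p
    have hcard' : (((F p).filter (·⁻¹ ∈ (g * ·) '' A)).card : ℝ) + (F p).card ≤
        ((F p).filter (·⁻¹ ∈ A)).card + (F p * insert 1 p.1).card := by
      exact_mod_cast hcard
    have hFp := hpos p
    simp only [φ]
    rw [div_add_div _ _ hFp.ne' hn1.ne', div_le_div_iff₀ hFp (by positivity)]
    nlinarith [mul_le_mul_of_nonneg_left hcard' hn1.le]
  refine ⟨μ, fun A => ge_of_tendsto' (hlim A) fun p => (hφ p A).1, ?_, fun A B hAB => ?_,
    fun g A => (hle g A).antisymm ?_⟩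
  · refine tendsto_nhds_unique (hlim _) (tendsto_const_nhds.congr fun p => ?_)
    simp [φ, (hpos p).ne']
  · refine tendsto_nhds_unique (hlim _) (((hlim A).add (hlim B)).congr fun p => ?_)
    have hdisj : Disjoint ((F p).filter (·⁻¹ ∈ A)) ((F p).filter (·⁻¹ ∈ B)) :=
      Finset.disjoint_filter.2 fun x _ hA hB => Set.disjoint_left.1 hAB hA hB
    simp only [φ, Set.mem_union, Finset.filter_or, Finset.card_union_of_disjoint hdisj,
      Nat.cast_add, add_div]
  · simpa only [Set.image_image, inv_mul_cancel_left, Set.image_id'] using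
      hle g⁻¹ ((g * ·) '' A)

/-- In a non-amenable group, right multiplication by a suitable finite set at least doubles the
size of every finite set. -/
theorem exists_two_mul_card_le_card_mul {G : Type*} [Group G] [DecidableEq G]
    (hG : ¬ IsAmenable G) :
    ∃ K : Finset G, ∀ F : Finset G, 2 * F.card ≤ (F * K).card := by
  obtain ⟨K, n, hK⟩ : ∃ (K : Finset G) (n : ℕ), ∀ F : Finset G, F.Nonempty →
      (n + 1) * F.card < n * (F * K).card := by
    by_contra! h
    exact hG (isAmenable_of_exists_card_mul_le h)
  have hn : 0 < n := by
    rcases Nat.eq_zero_or_pos n with rfl | hn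
    · simpa using hK {1} (Finset.singleton_nonempty 1)
    · exact hn
  have hpow (m : ℕ) (F : Finset G) : (n + 1) ^ m * F.card ≤ n ^ m * (F * K ^ m).card := by
    induction m generalizing F with
    | zero => simp
    | succ m ih =>
      have h1 : (n + 1) * F.card ≤ n * (F * K).card := by
        rcases F.eq_empty_or_nonempty with rfl | hF
        · simp
        · exact (hK F hF).le
      calc (n + 1) ^ (m + 1) * F.card = (n + 1) ^ m * ((n + 1) * F.card) := by ring
        _ ≤ (n + 1) ^ m * (n * (F * K).card) := by gcongr
        _ = n * ((n + 1) ^ m * (F * K).card) := by ring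
        _ ≤ n * (n ^ m * (F * K * K ^ m).card) := Nat.mul_le_mul_left n (ih _)
        _ = n ^ (m + 1) * (F * K ^ (m + 1)).card := by rw [pow_succ' K, mul_assoc F]; ring
  have hbern : n ^ n * 2 ≤ (n + 1) ^ n := by
    have hn0 : (0 : ℝ) < n := by exact_mod_cast hn
    have h1 : 1 + (n : ℝ) * (1 / n) ≤ (1 + 1 / n) ^ n :=
      one_add_mul_le_pow (by linarith [one_div_pos.2 hn0]) n
    rw [mul_one_div_cancel hn0.ne', one_add_one_eq_two] at h1
    have h2 : (n : ℝ) ^ n * 2 ≤ (n + 1) ^ n := by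
      calc (n : ℝ) ^ n * 2 ≤ n ^ n * (1 + 1 / n) ^ n := by gcongr
        _ = (n + 1) ^ n := by rw [← mul_pow, mul_add, mul_one, mul_one_div_cancel hn0.ne']
    exact_mod_cast h2
  refine ⟨K ^ n, fun F => Nat.le_of_mul_le_mul_left ?_ (pow_pos hn n)⟩
  calc n ^ n * (2 * F.card) = n ^ n * 2 * F.card := by ring
    _ ≤ (n + 1) ^ n * F.card := by gcongr
    _ ≤ _ := hpow n F

/-- On a non-amenable group there is a bounded-propagation `2:1` compressing vector
field: a map `f : G → G` with `f(x)⁻¹ x ∈ S` for a fixed finite set `S`, all of whose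
fibers have exactly two elements. -/
theorem exists_two_to_one_vector_field (G : Type*) [Group G]
    (hG : ¬ IsAmenable G) :
    ∃ (S : Finset G) (f : G → G),
      (∀ x : G, (f x)⁻¹ * x ∈ S) ∧ (∀ x : G, (f ⁻¹' {x}).ncard = 2) := by
  classical
  obtain ⟨K, hK⟩ := exists_two_mul_card_le_card_mul hG
  obtain ⟨i, hi, hiK⟩ := (Finset.all_card_le_biUnion_card_iff_exists_injective
    fun x : G × Bool => {x.1} * K).1 fun s => by
      calc s.card ≤ (s.image Prod.fst ×ˢ (Finset.univ : Finset Bool)).card :=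
            Finset.card_le_card fun x hx => by
              simpa using Finset.mem_image_of_mem Prod.fst hx
        _ = 2 * (s.image Prod.fst).card := by simp [mul_comm]
        _ ≤ (s.image Prod.fst * K).card := hK _
        _ ≤ _ := Finset.card_le_card fun x hx => by
          obtain ⟨y, hy, k, hk, rfl⟩ := Finset.mem_mul.1 hx
          obtain ⟨z, hz, rfl⟩ := Finset.mem_image.1 hy
          exact Finset.mem_biUnion.2 ⟨z, hz, Finset.mul_mem_mul (Finset.mem_singleton_self _) hk⟩
  obtain ⟨e, he, heS⟩ := Function.Embedding.schroeder_bernstein_of_rel hi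
    (g := fun x : G => (x, false)) (fun x y h => congrArg Prod.fst h)
    (fun x y => x.1⁻¹ * y ∈ insert 1 K)
    (fun x => by
      obtain ⟨y, hy, k, hk, hxk⟩ := Finset.mem_mul.1 (hiK x)
      rw [← hxk, Finset.mem_singleton.1 hy]
      simp [hk])
    (fun x => by simp)
  let E := Equiv.ofBijective e he
  refine ⟨insert 1 K, fun x => (E.symm x).1, fun x => ?_, fun x => ?_⟩
  · simpa only [show e (E.symm x) = x from E.apply_symm_apply x] using heS (E.symm x)
  · have : (fun y => (E.symm y).1) ⁻¹' {x} = {E (x, false), E (x, true)} := by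
      ext y
      obtain ⟨⟨z, b⟩, rfl⟩ := E.surjective y
      cases b <;> simp
    rw [this, Set.ncard_pair (E.injective.ne (by simp))]
end

section
/- Let G be a group, S a finite subset of G, and f: G → G a bounded-propagation 2:1 compressing vector field on G with propagation S. Fix a total order on S and an element q₀ ∈ Q, where Q = S × {0,1} × S. Define θ: Q^S → Q by: θ(φ) = (p, α, q) for the lexicographically minimal pair s < t in S with φ(s) = (s, α, p) and φ(t) = (t, β, q) for some β ∈ {0,1} and p, q ∈ S; and θ(φ) = q₀ if no such pair exists. Then the evolution map Θ: Q^G → Q^G of the cellular automaton θ is surjective; in particular θ admits no garden of Eden. -/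
variable {G : Type*} [Group G]

/-- Given `φ : S → Q` with `Q = S × {0,1} × S`, the pairs `s < t` in `S` such that
`φ s = (s, α, p)` and `φ t = (t, β, q)` for some `α, β, p, q`. -/
def goodPairs {G : Type*} [Group G] (S : Finset G) [LinearOrder ↥S]
    (φ : ↥S → ↥S × Bool × ↥S) : Set (↥S × ↥S) :=
  {st | st.1 < st.2 ∧ (φ st.1).1 = st.1 ∧ (φ st.2).1 = st.2}

/-- `st` is lexicographically minimal in the set `A` of pairs. -/
def IsLexMin {α : Type*} [LinearOrder α] (A : Set (α × α)) (st : α × α) : Prop :=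
  st ∈ A ∧ ∀ st' ∈ A, st.1 < st'.1 ∨ (st.1 = st'.1 ∧ st.2 ≤ st'.2)

/-- Let `f` be a bounded-propagation `2:1` compressing vector field on `G` with
propagation `S`, and let `θ` be the automaton with state set `Q = S × {0,1} × S`
sending `φ` to `(p, α, q)` for the lexicographically minimal pair `s < t` in `S` with
`φ s = (s, α, p)` and `φ t = (t, β, q)`, and to `q₀` when no such pair exists. Then the
evolution of `θ` is surjective; in particular `θ` admits no garden of Eden. -/
theorem surjective_of_vector_field (G : Type*) [Group G] (S : Finset G)
    [LinearOrder ↥S] (f : G → G)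
    (hf₁ : ∀ x : G, (f x)⁻¹ * x ∈ S)
    (hf₂ : ∀ x : G, (f ⁻¹' {x}).ncard = 2)
    (q₀ : ↥S × Bool × ↥S)
    (θ : (↥S → ↥S × Bool × ↥S) → ↥S × Bool × ↥S)
    (hθ₁ : ∀ (φ : ↥S → ↥S × Bool × ↥S) (st : ↥S × ↥S),
      IsLexMin (goodPairs S φ) st →
      θ φ = ((φ st.1).2.2, (φ st.1).2.1, (φ st.2).2.2))
    (hθ₂ : ∀ φ : ↥S → ↥S × Bool × ↥S, goodPairs S φ = ∅ → θ φ = q₀) :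
    Function.Surjective (evolve S θ) ∧ ¬ HasGOE S θ := by
  classical
  have surj : Function.Surjective (evolve S θ) := by
    intro ψ
    let σ : G → ↥S := fun y => ⟨(f y)⁻¹ * y, hf₁ y⟩
    let φ : G → ↥S × Bool × ↥S := fun y =>
      (σ y, (ψ (f y)).2.1,
        if ∃ z, f z = f y ∧ σ y < σ z then (ψ (f y)).1 else (ψ (f y)).2.2)
    have hσ : ∀ y, f y * (σ y : G) = y := fun y => mul_inv_cancel_left _ _
    have hφ : ∀ (x : G) (u : ↥S), (φ (x * u)).1 = u ↔ f (x * u) = x := by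
      intro x u
      change σ (x * u) = u ↔ _
      constructor
      · intro h
        have h' := hσ (x * u)
        rw [h] at h'
        exact mul_right_cancel h'
      · intro h
        apply Subtype.ext
        change (f (x * u))⁻¹ * (x * u) = u
        rw [h, inv_mul_cancel_left]
    refine ⟨φ, funext fun x => ?_⟩
    obtain ⟨s, t, hst, hfib⟩ : ∃ s t : ↥S, s < t ∧ f ⁻¹' {x} = {x * (s : G), x * (t : G)} := by
      obtain ⟨a, b, hab, h⟩ := Set.ncard_eq_two.1 (hf₂ x)
      have ha : f a = x := by
        have : a ∈ f ⁻¹' {x} := by simp [h]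
        exact this
      have hb : f b = x := by
        have : b ∈ f ⁻¹' {x} := by simp [h]
        exact this
      have ha' := hσ a
      have hb' := hσ b
      rw [ha] at ha'
      rw [hb] at hb'
      have hne : σ a ≠ σ b := fun e => hab (by rw [← ha', ← hb', e])
      rcases lt_or_gt_of_ne hne with hlt | hlt
      · exact ⟨σ a, σ b, hlt, by rw [ha', hb', h]⟩
      · exact ⟨σ b, σ a, hlt, by rw [ha', hb', h, Set.pair_comm]⟩
    have hmem : ∀ y, f y = x ↔ y = x * (s : G) ∨ y = x * (t : G) := fun y => by
      have : y ∈ f ⁻¹' {x} ↔ y ∈ ({x * (s : G), x * (t : G)} : Set G) := by rw [hfib]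
      simpa using this
    have hs : f (x * s) = x := (hmem _).2 (Or.inl rfl)
    have ht : f (x * t) = x := (hmem _).2 (Or.inr rfl)
    have hσs : σ (x * s) = s := (hφ x s).2 hs
    have hσt : σ (x * t) = t := (hφ x t).2 ht
    have hmin : IsLexMin (goodPairs S fun u => φ (x * u)) (s, t) := by
      refine ⟨⟨hst, hσs, hσt⟩, ?_⟩
      rintro ⟨u, v⟩ ⟨huv, hu, hv⟩
      have hu' := (hmem _).1 ((hφ x u).1 hu)
      have hv' := (hmem _).1 ((hφ x v).1 hv)
      simp only [mul_right_inj, Subtype.coe_inj] at hu' hv' huv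
      rcases hu' with rfl | rfl <;> rcases hv' with rfl | rfl
      · exact absurd huv (lt_irrefl _)
      · exact Or.inr ⟨rfl, le_rfl⟩
      · exact absurd huv hst.not_gt
      · exact absurd huv (lt_irrefl _)
    have hlow : ∃ z, f z = f (x * s) ∧ σ (x * s) < σ z :=
      ⟨x * t, by rw [hs, ht], by rwa [hσs, hσt]⟩
    have hhigh : ¬ ∃ z, f z = f (x * t) ∧ σ (x * t) < σ z := by
      rintro ⟨z, hz, hlt⟩
      rw [ht] at hz
      rw [hσt] at hlt
      rcases (hmem z).1 hz with rfl | rfl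
      · exact (hst.trans hlt).ne hσs.symm
      · exact hlt.ne hσt.symm
    change θ (fun u => φ (x * u)) = ψ x
    rw [hθ₁ _ _ hmin]
    rw [hs] at hlow
    rw [ht] at hhigh
    simp only [φ, hs, ht, if_pos hlow, if_neg hhigh]
  refine ⟨surj, ?_⟩
  rintro ⟨Y, p, hp⟩
  obtain ⟨φ, hφ⟩ := surj fun x => if h : x ∈ Y then p ⟨x, h⟩ else q₀
  obtain ⟨y, hy⟩ := hp φ
  exact hy (by simp [hφ])
end

section
/- Let G be a group, S a finite subset of G, and f: G → G a bounded-propagation 2:1 compressing vector field on G with propagation S. Fix a total order on S and an element q₀ ∈ Q, where Q = S × {0,1} × S. Define θ: Q^S → Q by: θ(φ) = (p, α, q) for the lexicographically minimal pair s < t in S with φ(s) = (s, α, p) and φ(t) = (t, β, q) for some β ∈ {0,1} and p, q ∈ S; and θ(φ) = q₀ if no such pair exists. Then the cellular automaton θ admits mutually erasable patterns; i.e. its evolution Θ is not pre-injective: there exist configurations ψ, ψ': G → Q differing at exactly one point with Θ(ψ) = Θ(ψ'). -/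
variable {G : Type*} [Group G]

/-- In a configuration where exactly the two cells `s < t` point back to the centre, the
only good pair is `(s, t)`, hence it is lexicographically minimal. -/
theorem isLexMin_goodPairs {G : Type*} [Group G] {S : Finset G} [LinearOrder ↥S]
    {φ : ↥S → ↥S × Bool × ↥S} {s t : ↥S} (hst : s < t)
    (h : ∀ u : ↥S, (φ u).1 = u ↔ u = s ∨ u = t) : IsLexMin (goodPairs S φ) (s, t) := by
  refine ⟨⟨hst, (h s).2 (Or.inl rfl), (h t).2 (Or.inr rfl)⟩, ?_⟩
  rintro ⟨u, v⟩ ⟨huv, hu, hv⟩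
  dsimp only at huv hu hv ⊢
  rcases (h u).1 hu with rfl | rfl
  · rcases (h v).1 hv with rfl | rfl
    · exact absurd huv (lt_irrefl _)
    · exact Or.inr ⟨rfl, le_rfl⟩
  · exact Or.inl hst

/-- For a `2:1` vector field, the offsets at which the preimages of `y` are found form an
ordered pair of distinct elements of `S`. -/
theorem exists_lt_forall_apply_mul_eq_iff {G : Type*} [Group G] {S : Finset G}
    [LinearOrder ↥S] {f : G → G} (hf₁ : ∀ x : G, (f x)⁻¹ * x ∈ S)
    (hf₂ : ∀ x : G, (f ⁻¹' {x}).ncard = 2) (y : G) :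
    ∃ s t : ↥S, s < t ∧ ∀ u : ↥S, f (y * (u : G)) = y ↔ u = s ∨ u = t := by
  obtain ⟨a, b, hab, h⟩ := Set.ncard_eq_two.1 (hf₂ y)
  have key : ∀ x, f x = y ↔ x = a ∨ x = b := fun x => by
    simpa using Set.ext_iff.1 h x
  have ha : y⁻¹ * a ∈ S := by simpa [(key a).2 (Or.inl rfl)] using hf₁ a
  have hb : y⁻¹ * b ∈ S := by simpa [(key b).2 (Or.inr rfl)] using hf₁ b
  have hu : ∀ u : ↥S, f (y * (u : G)) = y ↔ u = ⟨y⁻¹ * a, ha⟩ ∨ u = ⟨y⁻¹ * b, hb⟩ := by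
    intro u
    rw [key, Subtype.ext_iff, Subtype.ext_iff, eq_inv_mul_iff_mul_eq, eq_inv_mul_iff_mul_eq]
  have hne : (⟨y⁻¹ * a, ha⟩ : ↥S) ≠ ⟨y⁻¹ * b, hb⟩ := fun e =>
    hab (mul_left_cancel (Subtype.ext_iff.1 e))
  rcases hne.lt_or_gt with hlt | hlt
  · exact ⟨_, _, hlt, hu⟩
  · exact ⟨_, _, hlt, fun u => (hu u).trans or_comm⟩

/-- Let `f` be a bounded-propagation `2:1` compressing vector field on `G` with
propagation `S`, and let `θ` be the automaton with state set `Q = S × {0,1} × S`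
sending `φ` to `(p, α, q)` for the lexicographically minimal pair `s < t` in `S` with
`φ s = (s, α, p)` and `φ t = (t, β, q)`, and to `q₀` when no such pair exists. Then `θ`
admits mutually erasable patterns: its evolution is not pre-injective, as witnessed by
two configurations differing at exactly one point with the same image. -/
theorem mep_of_vector_field (G : Type*) [Group G] (S : Finset G)
    [LinearOrder ↥S] (f : G → G)
    (hf₁ : ∀ x : G, (f x)⁻¹ * x ∈ S)
    (hf₂ : ∀ x : G, (f ⁻¹' {x}).ncard = 2)
    (q₀ : ↥S × Bool × ↥S)
    (θ : (↥S → ↥S × Bool × ↥S) → ↥S × Bool × ↥S)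
    (hθ₁ : ∀ (φ : ↥S → ↥S × Bool × ↥S) (st : ↥S × ↥S),
      IsLexMin (goodPairs S φ) st →
      θ φ = ((φ st.1).2.2, (φ st.1).2.1, (φ st.2).2.2))
    (hθ₂ : ∀ φ : ↥S → ↥S × Bool × ↥S, goodPairs S φ = ∅ → θ φ = q₀) :
    ∃ (ψ ψ' : G → ↥S × Bool × ↥S) (x₀ : G),
      ψ x₀ ≠ ψ' x₀ ∧ (∀ x : G, x ≠ x₀ → ψ x = ψ' x) ∧
      evolve S θ ψ = evolve S θ ψ' := by
  classical
  choose s t hst hu using exists_lt_forall_apply_mul_eq_iff hf₁ hf₂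
  let σ : G → ↥S := fun x => ⟨(f x)⁻¹ * x, hf₁ x⟩
  have hσ : ∀ (y : G) (u : ↥S), σ (y * (u : G)) = u ↔ u = s y ∨ u = t y := fun y u => by
    rw [← hu, Subtype.ext_iff]
    change (f (y * (u : G)))⁻¹ * (y * (u : G)) = u ↔ _
    rw [← mul_assoc, mul_eq_right, inv_mul_eq_one]
  have hev : ∀ (α : G → Bool) (y : G),
      evolve S θ (fun x => (σ x, α x, s 1)) y = (s 1, α (y * (s y : G)), s 1) := fun α y =>
    hθ₁ _ (s y, t y) (isLexMin_goodPairs (hst y) (hσ y))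
  let x₀ : G := 1 * (t 1 : G)
  refine ⟨fun x => (σ x, false, s 1), fun x => (σ x, decide (x = x₀), s 1), x₀, ?_, ?_, ?_⟩
  · simp
  · intro x hx
    simp [hx]
  · funext y
    have hy : y * (s y : G) ≠ x₀ := fun e => by
      have h₁ : f x₀ = 1 := (hu 1 (t 1)).2 (Or.inr rfl)
      have h₂ : f x₀ = y := e ▸ (hu y (s y)).2 (Or.inl rfl)
      obtain rfl : y = 1 := h₂.symm.trans h₁
      exact (hst 1).ne (Subtype.ext (mul_left_cancel e))
    rw [hev (fun _ => false), hev (fun x => decide (x = x₀))]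
    simp [hy]
end

section
/- Let G be an amenable group and 𝕂 a field. Then the group algebra 𝕂G admits right common multiples: for any α, β ∈ 𝕂G there exist γ, δ ∈ 𝕂G with α·γ = β·δ and (γ, δ) ≠ (0, 0). -/
open scoped Pointwise in
/-- In an amenable group no finite set at least doubles the size of every finite set by multiplication. -/
theorem IsAmenable.exists_card_mul_lt {G : Type*} [Group G] [DecidableEq G] (hG : IsAmenable G)
    (S : Finset G) : ∃ F : Finset G, (S * F).card < 2 * F.card := by
  classical
  obtain ⟨μ, hnonneg, huniv, hadd, hinv⟩ := hG
  by_contra! hexp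
  -- The marriage theorem turns doubling into a paradoxical decomposition.
  obtain ⟨φ, hφ, hφS⟩ := (Finset.all_card_le_biUnion_card_iff_exists_injective
    (fun p : G × Bool => S.image (· * p.1))).1 fun T => by
      calc T.card ≤ (T.image Prod.fst ×ˢ (Finset.univ : Finset Bool)).card :=
            Finset.card_le_card fun p hp => by
              simp only [Finset.mem_product, Finset.mem_univ, and_true]
              exact Finset.mem_image_of_mem _ hp
        _ = 2 * (T.image Prod.fst).card := by simp [Finset.card_product, mul_comm]
        _ ≤ (S * T.image Prod.fst).card := hexp _
        _ ≤ _ := Finset.card_le_card fun x hx => by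
              obtain ⟨s, hs, g, hg, rfl⟩ := Finset.mem_mul.1 hx
              obtain ⟨p, hp, rfl⟩ := Finset.mem_image.1 hg
              exact Finset.mem_biUnion.2 ⟨p, hp, Finset.mem_image_of_mem (· * p.1) hs⟩
  have hempty : μ ∅ = 0 := by
    have := hadd ∅ ∅ (Set.disjoint_empty _)
    rw [Set.union_empty] at this
    linarith
  have hsum : ∀ {ι : Type _} (s : Finset ι) (A : ι → Set G),
      (∀ i ∈ s, ∀ j ∈ s, i ≠ j → Disjoint (A i) (A j)) →
      μ (⋃ i ∈ s, A i) = ∑ i ∈ s, μ (A i) := by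
    intro ι s A
    induction s using Finset.induction_on with
    | empty => simp [hempty]
    | insert a s ha ih =>
      intro h
      rw [Finset.set_biUnion_insert, Finset.sum_insert ha, hadd, ih]
      · exact fun i hi j hj => h i (Finset.mem_insert_of_mem hi) j (Finset.mem_insert_of_mem hj)
      · refine Set.disjoint_iUnion₂_right.2 fun i hi => ?_
        exact h a (Finset.mem_insert_self _ _) i (Finset.mem_insert_of_mem hi)
          fun e => ha (e ▸ hi)
  have hle : ∀ A, μ A ≤ 1 := fun A => by
    have := hadd A Aᶜ disjoint_compl_right
    rw [Set.union_compl_self, huniv] at this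
    linarith [hnonneg Aᶜ]
  let A : G × Bool → Set G := fun p => {g | φ (g, p.2) = p.1 * g}
  have hone : ∀ i : Bool, ∑ s ∈ S, μ (A (s, i)) = 1 := fun i => by
    rw [← hsum S (fun s => A (s, i)), ← huniv]
    · congr 1
      refine Set.eq_univ_of_forall fun g => ?_
      obtain ⟨s, hs, h⟩ := Finset.mem_image.1 (hφS (g, i))
      exact Set.mem_biUnion (Finset.mem_coe.2 hs) h.symm
    · intro s _ t _ hst
      refine Set.disjoint_left.2 fun g hs ht => hst ?_
      exact mul_right_cancel ((Eq.symm hs).trans ht)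
  have htwo : ∑ p ∈ S ×ˢ (Finset.univ : Finset Bool), μ ((p.1 * ·) '' A p) = 2 := by
    simp only [hinv]
    rw [Finset.sum_product_right]
    simp only [hone]
    norm_num
  rw [← hsum] at htwo
  · linarith [hle (⋃ p ∈ S ×ˢ (Finset.univ : Finset Bool), (p.1 * ·) '' A p)]
  · rintro ⟨s, i⟩ _ ⟨t, j⟩ _ hne
    refine Set.disjoint_left.2 ?_
    rintro _ ⟨g, hg, rfl⟩ ⟨h, hh, heq⟩
    have hg' : φ (g, i) = s * g := hg
    have hh' : φ (h, j) = t * h := hh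
    have heq' : t * h = s * g := heq
    obtain ⟨rfl, rfl⟩ := Prod.mk.inj (hφ (hh'.trans (heq'.trans hg'.symm)))
    exact hne (by rw [mul_right_cancel heq'])

theorem MonoidAlgebra.finrank_supported {𝕂 G : Type*} [Field 𝕂] (F : Finset G) :
    Module.finrank 𝕂 (MonoidAlgebra.supported 𝕂 𝕂 (F : Set G)) = F.card := by
  rw [(MonoidAlgebra.supportedEquivFinsupp (F : Set G)).finrank_eq]
  simp

instance MonoidAlgebra.finite_supported {𝕂 G : Type*} [Field 𝕂] (F : Finset G) :
    Module.Finite 𝕂 (MonoidAlgebra.supported 𝕂 𝕂 (F : Set G)) :=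
  Module.Finite.equiv (MonoidAlgebra.supportedEquivFinsupp (F : Set G)).symm

open scoped Pointwise in
theorem MonoidAlgebra.mul_mem_supported {𝕂 G : Type*} [Field 𝕂] [Group G] [DecidableEq G]
    {S F : Finset G} {x y : MonoidAlgebra 𝕂 G} (hx : x.coeff.support ⊆ S)
    (hy : y ∈ MonoidAlgebra.supported 𝕂 𝕂 (F : Set G)) :
    x * y ∈ MonoidAlgebra.supported 𝕂 𝕂 ((S * F : Finset G) : Set G) := by
  rw [MonoidAlgebra.mem_supported, Finset.coe_subset] at *
  exact (MonoidAlgebra.support_coeff_mul_subset _ _).trans (Finset.mul_subset_mul hx hy)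

open scoped Pointwise in
theorem MonoidAlgebra.exists_mul_eq_mul_of_card_mul_lt {𝕂 G : Type*} [Field 𝕂] [Group G]
    [DecidableEq G] {S F : Finset G} (hF : (S * F).card < 2 * F.card) {α β : MonoidAlgebra 𝕂 G}
    (hα : α.coeff.support ⊆ S) (hβ : β.coeff.support ⊆ S) :
    ∃ γ δ : MonoidAlgebra 𝕂 G, α * γ = β * δ ∧ ¬(γ = 0 ∧ δ = 0) := by
  let V := MonoidAlgebra.supported 𝕂 𝕂 (F : Set G)
  let L : V × V →ₗ[𝕂] MonoidAlgebra.supported 𝕂 𝕂 ((S * F : Finset G) : Set G) :=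
    (((LinearMap.mulLeft 𝕂 α).comp V.subtype).coprod
      (-(LinearMap.mulLeft 𝕂 β).comp V.subtype)).codRestrict _ fun v =>
        Submodule.add_mem _
          (MonoidAlgebra.mul_mem_supported hα v.1.2)
          (Submodule.neg_mem _
            (MonoidAlgebra.mul_mem_supported hβ v.2.2))
  have hker : LinearMap.ker L ≠ ⊥ := L.ker_ne_bot_of_finrank_lt <| by
    rw [Module.finrank_prod, MonoidAlgebra.finrank_supported, MonoidAlgebra.finrank_supported]
    omega
  obtain ⟨⟨γ, δ⟩, hv, hne⟩ := (Submodule.ne_bot_iff _).1 hker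
  refine ⟨γ, δ, ?_, fun h => hne (Prod.ext (Subtype.ext h.1) (Subtype.ext h.2))⟩
  have h : α * (γ : MonoidAlgebra 𝕂 G) + -(β * (δ : MonoidAlgebra 𝕂 G)) = 0 :=
    congrArg Subtype.val (LinearMap.mem_ker.1 hv)
  exact add_neg_eq_zero.1 h

/-- The group algebra of an amenable group admits right common multiples: for any
`α, β ∈ 𝕂G` there are `γ, δ ∈ 𝕂G`, not both zero, with `α·γ = β·δ`. -/
theorem amenable_common_multiples (G : Type*) [Group G] (hG : IsAmenable G)
    (𝕂 : Type*) [Field 𝕂] (α β : MonoidAlgebra 𝕂 G) :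
    ∃ γ δ : MonoidAlgebra 𝕂 G, α * γ = β * δ ∧ ¬(γ = 0 ∧ δ = 0) := by
  classical
  obtain ⟨F, hF⟩ := hG.exists_card_mul_lt (α.coeff.support ∪ β.coeff.support)
  exact MonoidAlgebra.exists_mul_eq_mul_of_card_mul_lt hF Finset.subset_union_left
    Finset.subset_union_right
end
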